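/- Let X and Y be real Hilbert spaces and let G : X → Y be Fréchet differentiable on the closed ball B of radius 2r around u₀ ∈ X, with derivative DG(u) a continuous linear map for each u ∈ B. Assume DG is bounded on B and that G satisfies the tangential cone condition: there is c > 0 such that ‖G(u) − G(ũ) − DG(u)(u − ũ)‖_Y ≤ c · ‖u − ũ‖_X · ‖G(u) − G(ũ)‖_Y for all u, ũ ∈ B. Fix ρ ∈ (0,1) and τ > 1/ρ, and let u† ∈ X denote the true parameter. Then there exists ε > 0 with the following property: if some u⋆ with G(u⋆) = G(u†) satisfies ‖u₀ − u⋆‖_X ≤ ε, then for every sequence of positive noise levels η_n → 0, every sequence of data y_n ∈ Y with ‖y_n − G(u†)‖_Y ≤ η_n, and every corresponding family of regularizing Levenberg–Marquardt iterations (u^{(n)}_m) started at u₀ (i.e., for each m with ‖y_n − G(u^{(n)}_m)‖_Y > τη_n, u^{(n)}_{m+1} = u^{(n)}_m + h^{(n)}_m where (DG(u^{(n)}_m)† ∘ DG(u^{(n)}_m) + α^{(n)}_m • id)(h^{(n)}_m) = DG(u^{(n)}_m)†(y_n − G(u^{(n)}_m)) and ‖y_n − G(u^{(n)}_m) − DG(u^{(n)}_m)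 h^{(n)}_m‖_Y = ρ‖y_n − G(u^{(n)}_m)‖_Y), with stopping indices k_n defined as the first index k with ‖y_n − G(u^{(n)}_k)‖_Y ≤ τη_n, each k_n is finite and there exists u∞ ∈ X with G(u∞) = G(u†) such that u^{(n)}_{k_n} → u∞ in X as n → ∞. -/

import Mathlib

open Metric Filter

/-- One regularizing Levenberg–Marquardt step, written in dual form with `β = 1/α`. -/
def LMStep {X Y : Type*}
    [NormedAddCommGroup X] [InnerProductSpace ℝ X]
    [NormedAddCommGroup Y] [InnerProductSpace ℝ Y]
    (ρ : ℝ) (A : X →L[ℝ] Y) (r : Y) (h : X) (β : ℝ) : Prop :=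
  0 < β ∧ (∀ z, inner ℝ h z = β * inner ℝ (r - A h) (A z)) ∧ ‖r - A h‖ = ρ * ‖r‖

section helpers

variable {X Y : Type*}
    [NormedAddCommGroup X] [InnerProductSpace ℝ X]
    [NormedAddCommGroup Y] [InnerProductSpace ℝ Y]

theorem LMStep.of_normal [CompleteSpace X] [CompleteSpace Y] {ρ α : ℝ} {A : X →L[ℝ] Y} {r : Y}
    {h : X} (hα : 0 < α)
    (he : ((ContinuousLinearMap.adjoint A).comp A + α • ContinuousLinearMap.id ℝ X) h
      = ContinuousLinearMap.adjoint A r) (hn : ‖r - A h‖ = ρ * ‖r‖) :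
    LMStep ρ A r h α⁻¹ := by
  refine ⟨by positivity, fun z => ?_, hn⟩
  have h1 : α • h = ContinuousLinearMap.adjoint A (r - A h) := by
    rw [map_sub, ← he]
    simp
  have h2 : α * inner ℝ h z = inner ℝ (r - A h) (A z) := by
    rw [← ContinuousLinearMap.adjoint_inner_left, ← h1, real_inner_smul_left]
  rw [← h2]
  field_simp

theorem LMStep.mono {ρ q β : ℝ} {A : X →L[ℝ] Y} {r : Y} {h : X} (hs : LMStep ρ A r h β)
    (hρ : 0 < ρ) (e : X) (hd : ‖r + A e‖ ≤ q * ‖r‖) :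
    ‖e + h‖ ^ 2 ≤ ‖e‖ ^ 2 - 2 * ρ * (ρ - q) * (β * ‖r‖ ^ 2) := by
  obtain ⟨hβ, hin, hn⟩ := hs
  set p := r - A h with hp
  have hAe : A e = (r + A e) - r := by abel
  have hAh : A h = r - p := by rw [hp]; abel
  set d := r + A e with hdd
  have h1 : inner ℝ h e = β * (inner ℝ p d - inner ℝ p r) := by
    rw [hin, hAe, inner_sub_right]
  have h2 : ‖h‖ ^ 2 = β * (inner ℝ p r - ‖p‖ ^ 2) := by
    rw [← real_inner_self_eq_norm_sq, hin, ← real_inner_self_eq_norm_sq p, ← inner_sub_right,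
      ← hAh]
  have h3 : ‖e + h‖ ^ 2 = ‖e‖ ^ 2 + 2 * inner ℝ h e + ‖h‖ ^ 2 := by
    rw [norm_add_sq_real, real_inner_comm]
  have h4 : 0 ≤ β * (inner ℝ p r - ‖p‖ ^ 2) := by rw [← h2]; positivity
  have h5 : inner ℝ p d ≤ ‖p‖ * (q * ‖r‖) :=
    (real_inner_le_norm p d).trans (by gcongr)
  have h6 : β * inner ℝ p d ≤ β * (‖p‖ * (q * ‖r‖)) := by gcongr
  rw [h3, h1, h2]
  rw [hn] at h4 h6 ⊢
  nlinarith

theorem LMStep.beta_low {ρ M β : ℝ} {A : X →L[ℝ] Y} {r : Y} {h : X} (hs : LMStep ρ A r h β)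
    (hρ1 : ρ < 1) (hM : 0 < M) (hA : ‖A‖ ≤ M) (hr : 0 < ‖r‖) :
    1 - ρ ≤ β * M ^ 2 := by
  obtain ⟨hβ, hin, hn⟩ := hs
  have h1 : ‖h‖ ^ 2 ≤ β * (ρ * ‖r‖) * (M * ‖h‖) := by
    rw [← real_inner_self_eq_norm_sq, hin, ← hn, mul_assoc]
    gcongr
    refine (real_inner_le_norm _ _).trans ?_
    gcongr
    exact A.le_of_opNorm_le hA h
  have h2 : (1 - ρ) * ‖r‖ ≤ M * ‖h‖ := by
    have := norm_sub_norm_le r (A h)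
    have h4 := A.le_of_opNorm_le hA h
    linarith
  have hh : 0 < ‖h‖ := by
    by_contra hcon
    have : ‖h‖ = 0 := le_antisymm (not_lt.mp hcon) (norm_nonneg _)
    rw [this] at h2
    nlinarith
  have h3 : ‖h‖ ≤ β * (ρ * ‖r‖) * M := by
    have : ‖h‖ * ‖h‖ ≤ (β * (ρ * ‖r‖) * M) * ‖h‖ := by nlinarith
    exact le_of_mul_le_mul_right this hh
  have h5 : (1 - ρ) * ‖r‖ ≤ (β * M ^ 2) * ‖r‖ := by
    have : M * ‖h‖ ≤ M * (β * (ρ * ‖r‖) * M) := by gcongr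
    have h6 : 0 ≤ (1 - ρ) * (β * M ^ 2 * ‖r‖) := mul_nonneg (by linarith) (by positivity)
    nlinarith
  exact le_of_mul_le_mul_right h5 hr

theorem LMStep.stab {ρ β β' : ℝ} {A A' : X →L[ℝ] Y} {r r' : Y} {h h' : X}
    (hs : LMStep ρ A r h β) (hs' : LMStep ρ A' r' h' β') (hρ : 0 < ρ) (hρ1 : ρ < 1) :
    ‖h - h'‖ ^ 2 ≤ 2 * (β * ‖r‖ + β' * ‖r'‖) * ‖r - r'‖
      + ‖A - A'‖ * (β * ‖r‖ * ‖h'‖ + β' * ‖r'‖ * ‖h‖) := by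
  obtain ⟨hβ, hin, hn⟩ := hs
  obtain ⟨hβ', hin', hn'⟩ := hs'
  set p := r - A h with hp
  set p' := r' - A' h' with hp'
  have e1 : A (h - h') = (r - r') - (p - p') - (A - A') h' := by
    simp only [hp, hp', map_sub, sub_apply]; abel
  have e2 : A' (h - h') = (r - r') - (p - p') - (A - A') h := by
    simp only [hp, hp', map_sub, sub_apply]; abel
  have h1 : ‖h - h'‖ ^ 2 = β * inner ℝ p (A (h - h')) - β' * inner ℝ p' (A' (h - h')) := by
    rw [← real_inner_self_eq_norm_sq, ← hin, ← hin', ← inner_sub_left]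
  have h2 : ‖h - h'‖ ^ 2 = β * inner ℝ p (r - r') - β' * inner ℝ p' (r - r')
      - β * ‖p‖ ^ 2 - β' * ‖p'‖ ^ 2 + (β + β') * inner ℝ p p'
      - β * inner ℝ p ((A - A') h') + β' * inner ℝ p' ((A - A') h) := by
    rw [h1, e1, e2]
    simp only [inner_sub_right, real_inner_self_eq_norm_sq, real_inner_comm p p']
    ring
  have b1 : inner ℝ p (r - r') ≤ ‖p‖ * ‖r - r'‖ := real_inner_le_norm _ _
  have b2 : -inner ℝ p' (r - r') ≤ ‖p'‖ * ‖r - r'‖ :=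
    (neg_le_abs _).trans (abs_real_inner_le_norm _ _)
  have b3 : inner ℝ p p' ≤ ‖p‖ * ‖p'‖ := real_inner_le_norm _ _
  have b4 : -inner ℝ p ((A - A') h') ≤ ‖p‖ * (‖A - A'‖ * ‖h'‖) :=
    ((neg_le_abs _).trans (abs_real_inner_le_norm _ _)).trans
      (by gcongr; exact (A - A').le_opNorm h')
  have b5 : inner ℝ p' ((A - A') h) ≤ ‖p'‖ * (‖A - A'‖ * ‖h‖) :=
    (real_inner_le_norm _ _).trans
      (by gcongr; exact (A - A').le_opNorm h)
  have c1 := mul_le_mul_of_nonneg_left b1 hβ.le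
  have c2 := mul_le_mul_of_nonneg_left b2 hβ'.le
  have c3 := mul_le_mul_of_nonneg_left b3 (add_pos hβ hβ').le
  have c4 := mul_le_mul_of_nonneg_left b4 hβ.le
  have c5 := mul_le_mul_of_nonneg_left b5 hβ'.le
  have hpr : ‖p‖ ≤ ‖r‖ := by rw [hn]; nlinarith [norm_nonneg r]
  have hpr' : ‖p'‖ ≤ ‖r'‖ := by rw [hn']; nlinarith [norm_nonneg r']
  have hdiff : |‖p‖ - ‖p'‖| ≤ ‖r - r'‖ := by
    rw [hn, hn', ← mul_sub, abs_mul, abs_of_pos hρ]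
    have := abs_norm_sub_norm_le r r'
    nlinarith [abs_nonneg (‖r‖ - ‖r'‖)]
  have hd := abs_le.mp hdiff
  have d1 : -((‖p‖ - ‖p'‖) * (β * ‖p‖ - β' * ‖p'‖)) ≤ ‖r - r'‖ * (β * ‖p‖ + β' * ‖p'‖) := by
    have k1 : 0 ≤ β * ‖p‖ := by positivity
    have k2 : 0 ≤ β' * ‖p'‖ := by positivity
    nlinarith
  have step : ‖h - h'‖ ^ 2 ≤ 2 * (β * ‖p‖ + β' * ‖p'‖) * ‖r - r'‖
      + ‖A - A'‖ * (β * ‖p‖ * ‖h'‖ + β' * ‖p'‖ * ‖h‖) := by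
    rw [h2]; nlinarith
  refine step.trans ?_
  gcongr

theorem cauchy_of_energy (v : ℕ → X) (x : X) (R : ℕ → ℝ) (C : ℝ) (hC : 0 ≤ C)
    (hE : ∀ i, ‖v (i + 1) - x‖ ^ 2 ≤ ‖v i - x‖ ^ 2)
    (hI : ∀ i l, R l ≤ R i → |inner ℝ (v (i + 1) - v i) (v l - x)|
      ≤ C * (‖v i - x‖ ^ 2 - ‖v (i + 1) - x‖ ^ 2)) : CauchySeq v := by
  set E : ℕ → ℝ := fun i => ‖v i - x‖ ^ 2 with hEdef
  have hanti : Antitone E := antitone_nat_of_succ_le hE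
  have key : ∀ j l k, j ≤ k → (∀ i, j ≤ i → i < k → R l ≤ R i) →
      |inner ℝ (v k - v j) (v l - x)| ≤ C * (E j - E k) := by
    intro j l k hjk
    induction k, hjk using Nat.le_induction with
    | base => intro _; simp
    | succ k hk ih =>
      intro hR
      have a1 := ih (fun i h1 h2 => hR i h1 (by omega))
      have a2 := hI k l (hR k hk (by omega))
      have : v (k + 1) - v j = (v (k + 1) - v k) + (v k - v j) := by abel
      rw [this, inner_add_left]
      refine (abs_add_le _ _).trans ?_
      simp only [hEdef] at a1 ⊢
      linarith
  have hdist : ∀ j k, j ≤ k → ‖v j - v k‖ ^ 2 ≤ 4 * (1 + 2 * C) * (E j - E k) := by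
    intro j k hjk
    obtain ⟨l, hl, hmin⟩ := Finset.exists_min_image (Finset.Icc j k) R ⟨j, by simp [hjk]⟩
    simp only [Finset.mem_Icc] at hl hmin
    have k1 := key j l l hl.1 (fun i h1 h2 => hmin i ⟨h1, by omega⟩)
    have k2 := key l l k hl.2 (fun i h1 h2 => hmin i ⟨by omega, by omega⟩)
    have n1 : E j = E l - 2 * inner ℝ (v l - v j) (v l - x) + ‖v l - v j‖ ^ 2 := by
      have : v j - x = (v l - x) - (v l - v j) := by abel
      simp only [hEdef]
      rw [this, norm_sub_sq_real, real_inner_comm]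
    have n2 : E k = E l + 2 * inner ℝ (v k - v l) (v l - x) + ‖v k - v l‖ ^ 2 := by
      have : v k - x = (v l - x) + (v k - v l) := by abel
      simp only [hEdef]
      rw [this, norm_add_sq_real, real_inner_comm]
    have m1 : E l ≤ E j := hanti hl.1
    have m2 : E k ≤ E l := hanti hl.2
    have k1' := abs_le.mp k1
    have k2' := abs_le.mp k2
    have t : ‖v j - v k‖ ≤ ‖v l - v j‖ + ‖v k - v l‖ := by
      have : v j - v k = -(v l - v j) - (v k - v l) := by abel
      rw [this]
      exact (norm_sub_le _ _).trans (by rw [norm_neg])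
    have t2 : ‖v j - v k‖ ^ 2 ≤ (‖v l - v j‖ + ‖v k - v l‖) ^ 2 := by gcongr
    have g1 : 0 ≤ C * (E l - E k) := mul_nonneg hC (by linarith)
    have g2 : 0 ≤ C * (E j - E l) := mul_nonneg hC (by linarith)
    nlinarith [sq_nonneg (‖v l - v j‖ - ‖v k - v l‖)]
  have hlim : CauchySeq E :=
    (tendsto_atTop_ciInf hanti ⟨0, by rintro _ ⟨i, rfl⟩; positivity⟩).cauchySeq
  rw [Metric.cauchySeq_iff'] at hlim ⊢
  intro ε hε
  obtain ⟨N, hN⟩ := hlim (ε ^ 2 / (4 * (1 + 2 * C))) (by positivity)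
  refine ⟨N, fun n hn => ?_⟩
  have h1 := hN n hn
  rw [Real.dist_eq, abs_sub_comm] at h1
  have h2 := (le_abs_self _).trans_lt h1
  have h3 := hdist N n hn
  rw [lt_div_iff₀ (by positivity)] at h2
  rw [dist_comm, dist_eq_norm]
  refine lt_of_pow_lt_pow_left₀ 2 hε.le ?_
  linarith

theorem DG_lip (G : X → Y) (DG : X → X →L[ℝ] Y) (u₀ : X) (r : ℝ)
    (M : ℝ) (c : ℝ) (hM : 0 < M) (hc : 0 < c)
    (hdiff : ∀ u ∈ closedBall u₀ (2 * r), HasFDerivWithinAt G (DG u) (closedBall u₀ (2 * r)) u)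
    (hbound : ∀ u ∈ closedBall u₀ (2 * r), ‖DG u‖ ≤ M)
    (htcc : ∀ u ∈ closedBall u₀ (2 * r), ∀ u' ∈ closedBall u₀ (2 * r),
      ‖G u - G u' - DG u (u - u')‖ ≤ c * ‖u - u'‖ * ‖G u - G u'‖)
    (u u' : X) (hu : ‖u - u₀‖ ≤ r) (hu' : ‖u' - u₀‖ ≤ r) (huu : ‖u - u'‖ ≤ r) :
    ‖DG u - DG u'‖ ≤ 6 * c * M * ‖u - u'‖ := by
  have hlip : ∀ a ∈ closedBall u₀ (2 * r), ∀ b ∈ closedBall u₀ (2 * r),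
      ‖G a - G b‖ ≤ M * ‖a - b‖ := fun a ha b hb =>
    (convex_closedBall u₀ (2 * r)).norm_image_sub_le_of_norm_hasFDerivWithin_le hdiff hbound hb ha
  have ht2 : ∀ a ∈ closedBall u₀ (2 * r), ∀ b ∈ closedBall u₀ (2 * r),
      ‖G a - G b - DG a (a - b)‖ ≤ c * M * ‖a - b‖ ^ 2 := fun a ha b hb => by
    refine (htcc a ha b hb).trans ?_
    have := mul_le_mul_of_nonneg_left (hlip a ha b hb) (by positivity : 0 ≤ c * ‖a - b‖)
    linarith
  have hr : 0 ≤ r := (norm_nonneg _).trans hu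
  have hub : u ∈ closedBall u₀ (2 * r) := by rw [mem_closedBall, dist_eq_norm]; linarith
  have hub' : u' ∈ closedBall u₀ (2 * r) := by rw [mem_closedBall, dist_eq_norm]; linarith
  set s := ‖u - u'‖ with hs
  have hs0 : 0 ≤ s := norm_nonneg _
  have key : ∀ h : X, ‖h‖ = s → ‖(DG u - DG u') h‖ ≤ 6 * c * M * s ^ 2 := by
    intro h hh
    have hw : u' + h ∈ closedBall u₀ (2 * r) := by
      rw [mem_closedBall, dist_eq_norm]
      have : u' + h - u₀ = (u' - u₀) + h := by abel
      rw [this]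
      refine (norm_add_le _ _).trans ?_
      linarith
    have a1 := ht2 u hub _ hw
    have a2 := ht2 u' hub' _ hw
    have a3 := ht2 u hub u' hub'
    have n1 : ‖u - (u' + h)‖ ≤ 2 * s := by
      have : u - (u' + h) = (u - u') - h := by abel
      rw [this]
      refine (norm_sub_le _ _).trans ?_
      linarith
    have n2 : ‖u' - (u' + h)‖ = s := by
      have : u' - (u' + h) = -h := by abel
      rw [this, norm_neg, hh]
    rw [n2] at a2
    rw [← hs] at a3
    have a1' : ‖G u - G (u' + h) - DG u (u - (u' + h))‖ ≤ c * M * (2 * s) ^ 2 :=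
      a1.trans (by gcongr)
    have e : (DG u - DG u') h = (G u - G (u' + h) - DG u (u - (u' + h)))
        - (G u' - G (u' + h) - DG u' (u' - (u' + h))) - (G u - G u' - DG u (u - u')) := by
      simp only [sub_apply, map_sub, map_add]; abel
    rw [e]
    refine (norm_sub_le _ _).trans ?_
    refine (add_le_add_left (norm_sub_le _ _) _).trans ?_
    linarith
  refine ContinuousLinearMap.opNorm_le_bound _ (by positivity) fun z => ?_
  by_cases hz : z = 0
  · simp [hz]
  rcases hs0.eq_or_lt with h0 | h0
  · have : u = u' := by rw [← sub_eq_zero, ← norm_eq_zero, ← hs, h0]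
    simp [this]
    positivity
  have hz' : 0 < ‖z‖ := norm_pos_iff.mpr hz
  have := key ((s / ‖z‖) • z) (by
    rw [norm_smul, Real.norm_of_nonneg (by positivity)]; field_simp)
  rw [map_smul, norm_smul, Real.norm_of_nonneg (by positivity), div_mul_eq_mul_div,
    div_le_iff₀ hz'] at this
  have h3 : s * ‖(DG u - DG u') z‖ ≤ s * (6 * c * M * s * ‖z‖) := by linarith
  exact le_of_mul_le_mul_left h3 h0

end helpers

/-- Convergence of Hanke's regularizing Levenberg–Marquardt scheme as the noise level
tends to zero. Under Fréchet differentiability on the closed ball `B` of radius `2r`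
around `u₀`, local boundedness of `DG`, and the tangential cone condition, there is
`ε > 0` such that: if some `u⋆` with `G u⋆ = G u†` lies within `ε` of `u₀`, then for
any positive noise levels `ηₙ → 0`, data `yₙ` with `‖yₙ − G u†‖ ≤ ηₙ`, and a family of
regularizing LM iterations started at `u₀`, the discrepancy-principle stopping index
`kₙ` (first index with `‖yₙ − G (u n k)‖ ≤ τ ηₙ`) exists (is finite) for each `n`, and
the stopped iterates `u n (kₙ)` converge to some `u∞` with `G u∞ = G u†`. -/
theorem stmt_1
    {X Y : Type*}
    [NormedAddCommGroup X] [InnerProductSpace ℝ X] [CompleteSpace X]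
    [NormedAddCommGroup Y] [InnerProductSpace ℝ Y] [CompleteSpace Y]
    (G : X → Y) (DG : X → X →L[ℝ] Y) (u₀ : X) (r : ℝ) (hr : 0 < r)
    (B : Set X) (hB : B = closedBall u₀ (2 * r))
    (hdiff : ∀ u ∈ B, HasFDerivWithinAt G (DG u) B u)
    (M : ℝ) (hM : 0 < M) (hbound : ∀ u ∈ B, ‖DG u‖ ≤ M)
    (c : ℝ) (hc : 0 < c)
    (htcc : ∀ u ∈ B, ∀ u' ∈ B,
      ‖G u - G u' - DG u (u - u')‖ ≤ c * ‖u - u'‖ * ‖G u - G u'‖)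
    (ρ τ : ℝ) (hρ : ρ ∈ Set.Ioo (0 : ℝ) 1) (hτ : 1 / ρ < τ)
    (udag : X) :
    ∃ ε > 0,
      (∃ ustar : X, G ustar = G udag ∧ ‖u₀ - ustar‖ ≤ ε) →
      ∀ η : ℕ → ℝ, (∀ n, 0 < η n) → Tendsto η atTop (nhds 0) →
      ∀ ys : ℕ → Y, (∀ n, ‖ys n - G udag‖ ≤ η n) →
      ∀ u : ℕ → ℕ → X, (∀ n, u n 0 = u₀) →
        (∀ n m : ℕ, τ * η n < ‖ys n - G (u n m)‖ →
          ∃ (h : X) (α : ℝ), 0 < α ∧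
            ((ContinuousLinearMap.adjoint (DG (u n m))).comp (DG (u n m))
                + α • ContinuousLinearMap.id ℝ X) h
              = ContinuousLinearMap.adjoint (DG (u n m)) (ys n - G (u n m)) ∧
            ‖ys n - G (u n m) - DG (u n m) h‖ = ρ * ‖ys n - G (u n m)‖ ∧
            u n (m + 1) = u n m + h) →
        (∀ n, ∃ k : ℕ, ‖ys n - G (u n k)‖ ≤ τ * η n) ∧
        ∀ k : ℕ → ℕ,
          (∀ n, ‖ys n - G (u n (k n))‖ ≤ τ * η n ∧
            ∀ j < k n, τ * η n < ‖ys n - G (u n j)‖) →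
          ∃ uinf : X, G uinf = G udag ∧
            Tendsto (fun n => u n (k n)) atTop (nhds uinf) := by
  subst hB
  obtain ⟨hρ0, hρ1⟩ := hρ
  have hτ0 : 0 < τ := lt_trans (by positivity) hτ
  have hτρ : 1 / τ < ρ := by
    rw [div_lt_iff₀ hρ0] at hτ
    rw [div_lt_iff₀ hτ0]; linarith
  have hτi : 0 < 1 / τ := by positivity
  obtain ⟨ε, hε, hεr, hεc⟩ : ∃ ε > 0, ε ≤ r / 2 ∧ c * (2 * ε) ≤ (ρ - 1 / τ) / 4 := by
    refine ⟨min (r / 2) ((ρ - 1 / τ) / (8 * c)), lt_min (by positivity)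
      (div_pos (by linarith) (by positivity)), min_le_left _ _, ?_⟩
    have := min_le_right (r / 2) ((ρ - 1 / τ) / (8 * c))
    rw [le_div_iff₀ (by positivity)] at this
    linarith
  refine ⟨ε, hε, ?_⟩
  rintro ⟨x₀, hx₀, hx₀ε⟩ η hη hηlim ys hys u hu0 hstep
  set y := G udag with hy
  -- geometry
  have hball : ∀ w, ‖w - x₀‖ ≤ ε → ‖w - u₀‖ ≤ r := by
    intro w hw
    have : w - u₀ = (w - x₀) - (u₀ - x₀) := by abel
    rw [this]
    refine (norm_sub_le _ _).trans ?_
    linarith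
  have hballB : ∀ w, ‖w - x₀‖ ≤ ε → w ∈ closedBall u₀ (2 * r) := by
    intro w hw
    rw [mem_closedBall, dist_eq_norm]
    linarith [hball w hw]
  have hpair : ∀ w w', ‖w - x₀‖ ≤ ε → ‖w' - x₀‖ ≤ ε → ‖w - w'‖ ≤ 2 * ε := by
    intro w w' hw hw'
    have : w - w' = (w - x₀) - (w' - x₀) := by abel
    rw [this]
    refine (norm_sub_le _ _).trans ?_
    linarith
  have hx₀self : ‖x₀ - x₀‖ ≤ ε := by simp [hε.le]
  set q := (1 / τ + ρ) / 2 with hq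
  set κ := 2 * ρ * (ρ - q) with hκdef
  have hκ : 0 < κ := by
    have : 0 < ρ - q := by rw [hq]; linarith
    positivity
  have one : ∀ n m, ‖u n m - x₀‖ ≤ ε → τ * η n < ‖ys n - G (u n m)‖ →
      ∃ h β, LMStep ρ (DG (u n m)) (ys n - G (u n m)) h β ∧ u n (m + 1) = u n m + h ∧
        ∀ x, G x = y → ‖x - x₀‖ ≤ ε →
          ‖u n (m + 1) - x‖ ^ 2
            ≤ ‖u n m - x‖ ^ 2 - κ * (β * ‖ys n - G (u n m)‖ ^ 2) := by
    intro n m hum hres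
    obtain ⟨h, α, hα, heq, hn, hnext⟩ := hstep n m hres
    have hs := LMStep.of_normal hα heq hn
    refine ⟨h, α⁻¹, hs, hnext, fun x hx hxε => ?_⟩
    have hd : ‖(ys n - G (u n m)) + DG (u n m) (u n m - x)‖ ≤ q * ‖ys n - G (u n m)‖ := by
      have e : (ys n - G (u n m)) + DG (u n m) (u n m - x)
          = (ys n - y) - (G (u n m) - G x - DG (u n m) (u n m - x)) := by
        rw [hx]; abel
      have t1 := htcc _ (hballB _ hum) _ (hballB _ hxε)
      have t2 : ‖G (u n m) - G x‖ ≤ ‖ys n - G (u n m)‖ + η n := by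
        have e2 : G (u n m) - G x = (ys n - y) - (ys n - G (u n m)) := by rw [hx]; abel
        rw [e2]
        refine (norm_sub_le _ _).trans ?_
        linarith [hys n]
      have t3 : η n ≤ 1 / τ * ‖ys n - G (u n m)‖ := by
        rw [div_mul_eq_mul_div, le_div_iff₀ hτ0]; linarith
      have t4 : c * ‖u n m - x‖ ≤ (ρ - 1 / τ) / 4 :=
        (mul_le_mul_of_nonneg_left (hpair _ _ hum hxε) hc.le).trans hεc
      have t5 : c * ‖u n m - x‖ * ‖G (u n m) - G x‖
          ≤ (ρ - 1 / τ) / 4 * (2 * ‖ys n - G (u n m)‖) := by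
        apply mul_le_mul t4 _ (norm_nonneg _) (by linarith)
        have : 1 / τ * ‖ys n - G (u n m)‖ ≤ 1 * ‖ys n - G (u n m)‖ := by
          gcongr; linarith
        linarith
      rw [e]
      refine (norm_sub_le _ _).trans ?_
      have := hys n
      rw [hq]
      linarith
    have := hs.mono hρ0 (u n m - x) hd
    rw [hnext]
    have e3 : u n m + h - x = u n m - x + h := by abel
    rw [e3]
    exact this
  -- monotonicity of the errors as long as the iteration is running
  have dec : ∀ n m, ‖u n m - x₀‖ ≤ ε → τ * η n < ‖ys n - G (u n m)‖ →
      ∀ x, G x = y → ‖x - x₀‖ ≤ ε → ‖u n (m + 1) - x‖ ≤ ‖u n m - x‖ := by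
    intro n m hum hres x hx hxε
    obtain ⟨h, β, hs, -, hd⟩ := one n m hum hres
    have := hd x hx hxε
    have hβ := hs.1
    refine le_of_sq_le_sq ?_ (norm_nonneg _)
    have : 0 ≤ κ * (β * ‖ys n - G (u n m)‖ ^ 2) := by positivity
    linarith
  have inball : ∀ n m, (∀ j < m, τ * η n < ‖ys n - G (u n j)‖) → ‖u n m - x₀‖ ≤ ε := by
    intro n m
    induction m with
    | zero => intro _; rw [hu0]; exact hx₀ε
    | succ m ih =>
      intro hal
      have h1 := ih (fun j hj => hal j (by omega))
      exact (dec n m h1 (hal m (by omega)) x₀ hx₀ hx₀self).trans h1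
  have decs : ∀ n m k, m ≤ k → (∀ j < k, τ * η n < ‖ys n - G (u n j)‖) →
      ∀ x, G x = y → ‖x - x₀‖ ≤ ε → ‖u n k - x‖ ≤ ‖u n m - x‖ := by
    intro n m k hmk
    induction k, hmk using Nat.le_induction with
    | base => intros; exact le_rfl
    | succ k hk ih =>
      intro hal x hx hxε
      have hal' : ∀ j < k, τ * η n < ‖ys n - G (u n j)‖ := fun j hj => hal j (by omega)
      exact (dec n k (inball n k hal') (hal k (by omega)) x hx hxε).trans (ih hal' x hx hxε)
  -- quantitative decrease
  have quant : ∀ n m, ‖u n m - x₀‖ ≤ ε → τ * η n < ‖ys n - G (u n m)‖ →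
      κ * (1 - ρ) * ‖ys n - G (u n m)‖ ^ 2
        ≤ M ^ 2 * (‖u n m - x₀‖ ^ 2 - ‖u n (m + 1) - x₀‖ ^ 2) := by
    intro n m hum hres
    obtain ⟨h, β, hs, -, hd⟩ := one n m hum hres
    have h1 := hd x₀ hx₀ hx₀self
    have hrpos : 0 < ‖ys n - G (u n m)‖ := lt_of_le_of_lt (by have := hη n; positivity) hres
    have h2 := hs.beta_low hρ1 hM (hbound _ (hballB _ hum)) hrpos
    have h3 : κ * (1 - ρ) * ‖ys n - G (u n m)‖ ^ 2
        ≤ κ * (β * M ^ 2) * ‖ys n - G (u n m)‖ ^ 2 := by gcongr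
    have h4 : M ^ 2 * (κ * (β * ‖ys n - G (u n m)‖ ^ 2))
        ≤ M ^ 2 * (‖u n m - x₀‖ ^ 2 - ‖u n (m + 1) - x₀‖ ^ 2) := by gcongr; linarith
    linarith
  have quant2 : ∀ n m, ‖u n m - x₀‖ ≤ ε → τ * η n < ‖ys n - G (u n m)‖ → ∀ z,
      κ * (|inner ℝ (u n (m + 1) - u n m) z| * ‖ys n - G (u n m)‖)
        ≤ (‖u n m - x₀‖ ^ 2 - ‖u n (m + 1) - x₀‖ ^ 2) * ‖DG (u n m) z‖ := by
    intro n m hum hres z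
    obtain ⟨h, β, hs, hnext, hd⟩ := one n m hum hres
    have h1 := hd x₀ hx₀ hx₀self
    obtain ⟨hβ, hin, hn⟩ := hs
    have e : u n (m + 1) - u n m = h := by rw [hnext]; abel
    rw [e, hin, abs_mul, abs_of_pos hβ]
    have h2 : |inner ℝ (ys n - G (u n m) - DG (u n m) h) (DG (u n m) z)|
        ≤ ‖ys n - G (u n m)‖ * ‖DG (u n m) z‖ := by
      refine (abs_real_inner_le_norm _ _).trans ?_
      gcongr
      rw [hn]
      nlinarith [norm_nonneg (ys n - G (u n m))]
    calc κ * (β * |inner ℝ (ys n - G (u n m) - DG (u n m) h) (DG (u n m) z)|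
            * ‖ys n - G (u n m)‖)
        ≤ κ * (β * (‖ys n - G (u n m)‖ * ‖DG (u n m) z‖) * ‖ys n - G (u n m)‖) := by gcongr
      _ = (κ * (β * ‖ys n - G (u n m)‖ ^ 2)) * ‖DG (u n m) z‖ := by ring
      _ ≤ _ := by gcongr; linarith
  have hGlip : ∀ a ∈ closedBall u₀ (2 * r), ∀ b ∈ closedBall u₀ (2 * r),
      ‖G a - G b‖ ≤ M * ‖a - b‖ := fun a ha b hb =>
    (convex_closedBall u₀ (2 * r)).norm_image_sub_le_of_norm_hasFDerivWithin_le hdiff hbound hb ha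
  have hDGlip : ∀ a b, ‖a - x₀‖ ≤ ε → ‖b - x₀‖ ≤ ε →
      ‖DG a - DG b‖ ≤ 6 * c * M * ‖a - b‖ := fun a b ha hb =>
    DG_lip G DG u₀ r M c hM hc hdiff hbound htcc a b (hball a ha) (hball b hb)
      ((hpair a b ha hb).trans (by linarith))
  have hyslim : Tendsto ys atTop (nhds y) := by
    rw [tendsto_iff_norm_sub_tendsto_zero]
    exact squeeze_zero (fun _ => norm_nonneg _) hys hηlim
  refine ⟨fun n => ?_, ?_⟩
  · -- finiteness of the stopping index
    by_contra hcon
    push Not at hcon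
    set δ := κ * (1 - ρ) * (τ * η n) ^ 2 / M ^ 2 with hδ
    have hηn := hη n
    have h1ρ : 0 < 1 - ρ := by linarith
    have hδ0 : 0 < δ := by positivity
    have hdecr : ∀ m : ℕ, ‖u n m - x₀‖ ^ 2 ≤ ε ^ 2 - m * δ := by
      intro m
      induction m with
      | zero =>
        have := inball n 0 (fun j _ => hcon j)
        have : ‖u n 0 - x₀‖ ^ 2 ≤ ε ^ 2 := by gcongr
        simpa using this
      | succ m ih =>
        have h1 := quant n m (inball n m (fun j _ => hcon j)) (hcon m)
        have h2 : κ * (1 - ρ) * (τ * η n) ^ 2 ≤ κ * (1 - ρ) * ‖ys n - G (u n m)‖ ^ 2 := by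
          have := (hcon m).le
          gcongr
        have h3 : δ ≤ ‖u n m - x₀‖ ^ 2 - ‖u n (m + 1) - x₀‖ ^ 2 := by
          rw [hδ, div_le_iff₀ (by positivity)]; linarith
        push_cast
        linarith
    obtain ⟨m, hm⟩ := exists_nat_gt (ε ^ 2 / δ)
    rw [div_lt_iff₀ hδ0] at hm
    have := hdecr m
    have := sq_nonneg ‖u n m - x₀‖
    linarith
  intro k hk
  -- `Q m v`: the iteration eventually runs for `m` steps and the `m`-th iterates tend to `v`
  let Q : ℕ → X → Prop := fun m v =>
    (∀ᶠ n in atTop, ∀ j < m, τ * η n < ‖ys n - G (u n j)‖) ∧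
      Tendsto (fun n => u n m) atTop (nhds v)
  have Qball : ∀ m v, Q m v → ‖v - x₀‖ ≤ ε := by
    rintro m v ⟨h1, h2⟩
    refine le_of_tendsto (h2.sub_const x₀).norm ?_
    filter_upwards [h1] with n hn using inball n m hn
  have Qev : ∀ m v, Q m v → ∀ᶠ n in atTop, ‖u n m - x₀‖ ≤ ε := by
    rintro m v ⟨h1, h2⟩
    filter_upwards [h1] with n hn using inball n m hn
  have QG : ∀ m v, Q m v → Tendsto (fun n => G (u n m)) atTop (nhds (G v)) := by
    intro m v hQ
    rw [tendsto_iff_norm_sub_tendsto_zero]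
    have h0 := (tendsto_iff_norm_sub_tendsto_zero.mp hQ.2).const_mul M
    rw [mul_zero] at h0
    refine squeeze_zero' (Eventually.of_forall fun _ => norm_nonneg _) ?_ h0
    filter_upwards [Qev m v hQ] with n hn using
      hGlip _ (hballB _ hn) _ (hballB _ (Qball m v hQ))
  have QDG : ∀ m v, Q m v → Tendsto (fun n => DG (u n m)) atTop (nhds (DG v)) := by
    intro m v hQ
    rw [tendsto_iff_norm_sub_tendsto_zero]
    have h0 := (tendsto_iff_norm_sub_tendsto_zero.mp hQ.2).const_mul (6 * c * M)
    rw [mul_zero] at h0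
    refine squeeze_zero' (Eventually.of_forall fun _ => norm_nonneg _) ?_ h0
    filter_upwards [Qev m v hQ] with n hn using hDGlip _ _ hn (Qball m v hQ)
  have Qr : ∀ m v, Q m v →
      Tendsto (fun n => ys n - G (u n m)) atTop (nhds (y - G v)) :=
    fun m v hQ => hyslim.sub (QG m v hQ)
  have hτη : Tendsto (fun n => τ * η n) atTop (nhds 0) := by
    simpa using hηlim.const_mul τ
  -- stability of a single step
  have Qsucc : ∀ m v, Q m v → G v ≠ y → ∃ v', Q (m + 1) v' := by
    intro m v hQ hv
    have hpos : 0 < ‖y - G v‖ := norm_pos_iff.mpr (sub_ne_zero.mpr (Ne.symm hv))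
    have ev1 : ∀ᶠ n in atTop, τ * η n < ‖ys n - G (u n m)‖ :=
      hτη.eventually_lt (Qr m v hQ).norm hpos
    have ev2 : ∀ᶠ n in atTop, ‖y - G v‖ / 2 < ‖ys n - G (u n m)‖ :=
      (Qr m v hQ).norm.eventually_const_lt (by linarith)
    set a := ‖y - G v‖ / 2 with ha
    have ha0 : 0 < a := by positivity
    set K := ε ^ 2 / (κ * a) with hK
    have hK0 : 0 < K := by positivity
    have hcau : CauchySeq (fun n => u n (m + 1) - u n m) := by
      have evall : ∀ᶠ n in atTop, ∃ β, LMStep ρ (DG (u n m)) (ys n - G (u n m))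
          (u n (m + 1) - u n m) β ∧ β * ‖ys n - G (u n m)‖ ≤ K ∧
          ‖u n (m + 1) - u n m‖ ≤ 2 * ε := by
        filter_upwards [ev1, ev2, Qev m v hQ] with n h1 h2 h3
        obtain ⟨h, β, hs, hnext, hd⟩ := one n m h3 h1
        have e : u n (m + 1) - u n m = h := by rw [hnext]; abel
        have hnx := (dec n m h3 h1 x₀ hx₀ hx₀self).trans h3
        refine ⟨β, by rw [e]; exact hs, ?_, hpair _ _ hnx h3⟩
        have hd0 := hd x₀ hx₀ hx₀self
        have hβ := hs.1
        have g1 : ‖u n m - x₀‖ ^ 2 ≤ ε ^ 2 := by gcongr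
        have g2 := sq_nonneg ‖u n (m + 1) - x₀‖
        rw [hK, le_div_iff₀ (by positivity)]
        have g3 : κ * (β * ‖ys n - G (u n m)‖ * a)
            ≤ κ * (β * ‖ys n - G (u n m)‖ * ‖ys n - G (u n m)‖) := by gcongr
        linarith
      have c1 := Metric.cauchySeq_iff.mp (Qr m v hQ).cauchySeq
      have c2 := Metric.cauchySeq_iff.mp (QDG m v hQ).cauchySeq
      obtain ⟨N0, hN0⟩ := eventually_atTop.mp evall
      rw [Metric.cauchySeq_iff]
      intro e he
      obtain ⟨N1, hN1⟩ := c1 (e ^ 2 / (8 * K)) (by positivity)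
      obtain ⟨N2, hN2⟩ := c2 (e ^ 2 / (8 * K * ε)) (by positivity)
      refine ⟨max N0 (max N1 N2), fun n hn n' hn' => ?_⟩
      simp only [ge_iff_le, max_le_iff] at hn hn'
      obtain ⟨β, hs, hb, hh⟩ := hN0 n hn.1
      obtain ⟨β', hs', hb', hh'⟩ := hN0 n' hn'.1
      have d1 := hN1 n hn.2.1 n' hn'.2.1
      have d2 := hN2 n hn.2.2 n' hn'.2.2
      rw [dist_eq_norm] at d1 d2 ⊢
      have hst := hs.stab hs' hρ0 hρ1
      rw [lt_div_iff₀ (by positivity)] at d1 d2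
      refine lt_of_pow_lt_pow_left₀ 2 he.le ?_
      refine hst.trans_lt ?_
      have hβ := hs.1
      have hβ' := hs'.1
      have s1 : 2 * (β * ‖ys n - G (u n m)‖ + β' * ‖ys n' - G (u n' m)‖)
            * ‖ys n - G (u n m) - (ys n' - G (u n' m))‖
          ≤ 2 * (K + K) * ‖ys n - G (u n m) - (ys n' - G (u n' m))‖ := by gcongr
      have s2 : ‖DG (u n m) - DG (u n' m)‖ *
            (β * ‖ys n - G (u n m)‖ * ‖u n' (m + 1) - u n' m‖
              + β' * ‖ys n' - G (u n' m)‖ * ‖u n (m + 1) - u n m‖)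
          ≤ ‖DG (u n m) - DG (u n' m)‖ * (K * (2 * ε) + K * (2 * ε)) := by gcongr
      linarith
    obtain ⟨h, hh⟩ := cauchySeq_tendsto_of_complete hcau
    refine ⟨v + h, ?_, ?_⟩
    · filter_upwards [ev1, hQ.1] with n h1 h2 j hj
      rcases Nat.lt_succ_iff_lt_or_eq.mp hj with h | h
      · exact h2 j h
      · rw [h]; exact h1
    · refine (hQ.2.add hh).congr fun n => ?_
      abel
  -- conclusion from approximability
  have conclude : ∀ w, G w = y → ‖w - x₀‖ ≤ ε →
      (∀ e > 0, ∃ m v, Q m v ∧ ‖v - w‖ < e) →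
      Tendsto (fun n => u n (k n)) atTop (nhds w) := by
    intro w hw hwε happ
    rw [Metric.tendsto_nhds]
    intro e he
    obtain ⟨m, v, hQ, hvw⟩ := happ e he
    have ev : ∀ᶠ n in atTop, ‖u n m - w‖ < e :=
      (hQ.2.sub_const w).norm.eventually_lt_const hvw
    filter_upwards [ev, hQ.1] with n h1 h2
    have hmk : m ≤ k n := by
      by_contra hlt
      exact absurd (hk n).1 (not_le.mpr (h2 (k n) (not_le.mp hlt)))
    rw [dist_eq_norm]
    exact (decs n m (k n) hmk (hk n).2 w hw hwε).trans_lt h1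
  by_cases hcase : ∃ m v, Q m v ∧ G v = y
  · obtain ⟨m, v, hQ, hv⟩ := hcase
    exact ⟨v, hv, conclude v hv (Qball m v hQ) fun e he => ⟨m, v, hQ, by simpa using he⟩⟩
  push Not at hcase
  have hex : ∀ m, ∃ v, Q m v := by
    intro m
    induction m with
    | zero =>
      refine ⟨u₀, Eventually.of_forall fun n j hj => absurd hj (by omega), ?_⟩
      simp only [hu0]
      exact tendsto_const_nhds
    | succ m ih =>
      obtain ⟨v, hv⟩ := ih
      exact Qsucc m v hv (hcase m v hv)
  choose v hv using hex
  have hvb : ∀ m, ‖v m - x₀‖ ≤ ε := fun m => Qball m _ (hv m)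
  have hRpos : ∀ m, 0 < ‖y - G (v m)‖ := fun m =>
    norm_pos_iff.mpr (sub_ne_zero.mpr (Ne.symm (hcase m _ (hv m))))
  have ev1 : ∀ m, ∀ᶠ n in atTop, τ * η n < ‖ys n - G (u n m)‖ := fun m =>
    hτη.eventually_lt (Qr m _ (hv m)).norm (hRpos m)
  have tE : ∀ m, Tendsto (fun n => ‖u n m - x₀‖ ^ 2) atTop (nhds (‖v m - x₀‖ ^ 2)) := fun m =>
    ((hv m).2.sub_const x₀).norm.pow 2
  have L1 : ∀ m, κ * (1 - ρ) * ‖y - G (v m)‖ ^ 2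
      ≤ M ^ 2 * (‖v m - x₀‖ ^ 2 - ‖v (m + 1) - x₀‖ ^ 2) := by
    intro m
    refine le_of_tendsto_of_tendsto (((Qr m _ (hv m)).norm.pow 2).const_mul _)
      (((tE m).sub (tE (m + 1))).const_mul _) ?_
    filter_upwards [ev1 m, Qev m _ (hv m)] with n h1 h2 using quant n m h2 h1
  have L2 : ∀ m z, κ * (|inner ℝ (v (m + 1) - v m) z| * ‖y - G (v m)‖)
      ≤ (‖v m - x₀‖ ^ 2 - ‖v (m + 1) - x₀‖ ^ 2) * ‖DG (v m) z‖ := by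
    intro m z
    have t1 : Tendsto (fun n => |inner ℝ (u n (m + 1) - u n m) z|) atTop
        (nhds |inner ℝ (v (m + 1) - v m) z|) :=
      ((((hv (m + 1)).2.sub (hv m).2).inner tendsto_const_nhds)).abs
    have t2 : Tendsto (fun n => ‖DG (u n m) z‖) atTop (nhds ‖DG (v m) z‖) :=
      (((ContinuousLinearMap.apply ℝ Y z).continuous.tendsto _).comp (QDG m _ (hv m))).norm
    refine le_of_tendsto_of_tendsto ((t1.mul (Qr m _ (hv m)).norm).const_mul _)
      (((tE m).sub (tE (m + 1))).mul t2) ?_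
    filter_upwards [ev1 m, Qev m _ (hv m)] with n h1 h2 using quant2 n m h2 h1 z
  have hEd : ∀ m, ‖v (m + 1) - x₀‖ ^ 2 ≤ ‖v m - x₀‖ ^ 2 := by
    intro m
    have h1 := L1 m
    have h1ρ : 0 < 1 - ρ := by linarith
    have h2 : 0 ≤ κ * (1 - ρ) * ‖y - G (v m)‖ ^ 2 := by positivity
    have h3 := nonneg_of_mul_nonneg_right (h2.trans h1) (by positivity : 0 < M ^ 2)
    linarith
  have hA : ∀ i w, ‖w - x₀‖ ≤ ε → ‖DG (v i) (v i - w)‖ ≤ 2 * ‖G (v i) - G w‖ := by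
    intro i w hw
    have t1 := htcc _ (hballB _ (hvb i)) _ (hballB _ hw)
    have t4 : c * ‖v i - w‖ ≤ 1 :=
      ((mul_le_mul_of_nonneg_left (hpair _ _ (hvb i) hw) hc.le).trans hεc).trans (by linarith)
    have t5 : c * ‖v i - w‖ * ‖G (v i) - G w‖ ≤ 1 * ‖G (v i) - G w‖ := by gcongr
    have t6 := norm_sub_le (G (v i) - G w) (G (v i) - G w - DG (v i) (v i - w))
    rw [sub_sub_cancel] at t6
    linarith
  have hcau : CauchySeq v := by
    refine cauchy_of_energy v x₀ (fun i => ‖y - G (v i)‖) (6 / κ) (by positivity) hEd ?_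
    intro i l hl
    have b1 := hA i x₀ hx₀self
    have b2 := hA i (v l) (hvb l)
    have b3 : ‖G (v i) - G (v l)‖ ≤ ‖y - G (v i)‖ + ‖y - G (v l)‖ := by
      have : G (v i) - G (v l) = (y - G (v l)) - (y - G (v i)) := by abel
      rw [this]
      exact (norm_sub_le _ _).trans (by linarith)
    rw [hx₀, norm_sub_rev _ y] at b1
    have b4 : ‖DG (v i) (v l - x₀)‖ ≤ 6 * ‖y - G (v i)‖ := by
      have : v l - x₀ = (v i - x₀) - (v i - v l) := by abel
      rw [this, map_sub]
      refine (norm_sub_le _ _).trans ?_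
      linarith
    have b5 := L2 i (v l - x₀)
    have b6 : κ * (|inner ℝ (v (i + 1) - v i) (v l - x₀)| * ‖y - G (v i)‖)
        ≤ (‖v i - x₀‖ ^ 2 - ‖v (i + 1) - x₀‖ ^ 2) * (6 * ‖y - G (v i)‖) :=
      b5.trans (mul_le_mul_of_nonneg_left b4 (by linarith [hEd i]))
    rw [div_mul_eq_mul_div, le_div_iff₀ hκ]
    refine le_of_mul_le_mul_right ?_ (hRpos i)
    linarith
  obtain ⟨w, hw⟩ := cauchySeq_tendsto_of_complete hcau
  have hwε : ‖w - x₀‖ ≤ ε :=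
    le_of_tendsto (hw.sub_const x₀).norm (Eventually.of_forall hvb)
  have hGw : Tendsto (fun m => G (v m)) atTop (nhds (G w)) := by
    rw [tendsto_iff_norm_sub_tendsto_zero]
    have h0 := (tendsto_iff_norm_sub_tendsto_zero.mp hw).const_mul M
    rw [mul_zero] at h0
    exact squeeze_zero (fun _ => norm_nonneg _)
      (fun m => hGlip _ (hballB _ (hvb m)) _ (hballB _ hwε)) h0
  have hGwy : G w = y := by
    have tw : Tendsto (fun m => ‖v m - x₀‖ ^ 2) atTop (nhds (‖w - x₀‖ ^ 2)) :=
      (hw.sub_const x₀).norm.pow 2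
    have tw' := tw.comp (tendsto_add_atTop_nat 1)
    have h1 : κ * (1 - ρ) * ‖y - G w‖ ^ 2
        ≤ M ^ 2 * (‖w - x₀‖ ^ 2 - ‖w - x₀‖ ^ 2) :=
      le_of_tendsto_of_tendsto (((hGw.const_sub y).norm.pow 2).const_mul _)
        ((tw.sub tw').const_mul _) (Eventually.of_forall L1)
    rw [sub_self, mul_zero] at h1
    have h1ρ : 0 < 1 - ρ := by linarith
    have h2 : ‖y - G w‖ ^ 2 ≤ 0 := by
      by_contra hcon
      have := mul_pos (mul_pos hκ h1ρ) (not_le.mp hcon)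
      linarith
    have h3 : ‖y - G w‖ = 0 := by
      have := sq_nonneg ‖y - G w‖
      exact pow_eq_zero_iff (two_ne_zero) |>.mp (le_antisymm h2 this)
    exact (sub_eq_zero.mp (norm_eq_zero.mp h3)).symm
  refine ⟨w, hGwy, conclude w hGwy hwε fun e he => ?_⟩
  have := (hw.sub_const w).norm.eventually_lt_const (u := e) (by simpa using he)
  obtain ⟨m, hm⟩ := this.exists
  exact ⟨m, v m, hv m, hm⟩
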